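/- Let F act on a tree T with orientation o and base vertex v₀, and let δ : V → V be the Dehn twist map based at v₀. Then the defining formula for δ is independent of the choice of walk: for every vertex v ∈ V and every walk from v₀ to v (not necessarily a path) with consecutive oriented edges e₁,…,e_k, one has δ(v) = o(e₁)⋯o(e_k) • v. -/

import Mathlib

/-- The product `o(e₁)⋯o(e_k)` of the orientation values over the consecutive
oriented edges (darts) of a walk `p`. -/
def walkProd {V F : Type*} [Group F] {G : SimpleGraph V} {u v : V}
    (o : V → V → F) (p : G.Walk u v) : F :=
  (p.darts.map fun d => o d.toProd.1 d.toProd.2).prod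

theorem walkProd_cons {V F : Type*} [Group F] {G : SimpleGraph V} (o : V → V → F)
    {u v w : V} (h : G.Adj u v) (p : G.Walk v w) :
    walkProd o (SimpleGraph.Walk.cons h p) = o u v * walkProd o p := by
  simp [walkProd]

/-- In an acyclic graph, every walk has the same product as some path with the same endpoints. -/
theorem exists_isPath_walkProd_eq {V F : Type*} [Group F] {G : SimpleGraph V}
    (hG : G.IsAcyclic) (o : V → V → F) (ho : ∀ u v, G.Adj u v → o v u = (o u v)⁻¹)
    {u v : V} (p : G.Walk u v) :
    ∃ q : G.Walk u v, q.IsPath ∧ walkProd o q = walkProd o p := by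
  induction p with
  | nil => exact ⟨.nil, .nil, rfl⟩
  | @cons u w v h p ih =>
    obtain ⟨q, hq, hqp⟩ := ih
    by_cases hu : u ∈ q.support
    · have hsnd := hG.eq_snd_of_adj_start hq h.symm hu
      cases q with
      | nil =>
        rw [SimpleGraph.Walk.support_nil, List.mem_singleton] at hu
        exact absurd hu h.ne
      | cons h' q =>
        rw [SimpleGraph.Walk.snd_cons] at hsnd
        subst hsnd
        refine ⟨q, hq.of_cons, ?_⟩
        rw [walkProd_cons, ← hqp, walkProd_cons, ho _ _ h, mul_inv_cancel_left]
    · exact ⟨.cons h q, hq.cons hu, by rw [walkProd_cons, walkProd_cons, hqp]⟩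

/-- Let `F` act on a tree `G` by graph automorphisms, with orientation `o` and
base vertex `v₀`, and let `δ` be the Dehn twist map based at `v₀`.  Then the
defining formula for `δ` is independent of the choice of walk: for every vertex
`v` and every walk `p` from `v₀` to `v` (not necessarily a path),
`δ v = o(e₁)⋯o(e_k) • v`. -/
theorem dehnTwist_walk_independent
    {V F : Type*} [Group F] [MulAction F V]
    (G : SimpleGraph V) (hT : G.IsTree)
    (hact : ∀ (g : F) (u v : V), G.Adj u v ↔ G.Adj (g • u) (g • v))
    (o : V → V → F)
    (ho1 : ∀ u v, G.Adj u v → o v u = (o u v)⁻¹)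
    (ho2 : ∀ (g : F) (u v : V), G.Adj u v → o (g • u) (g • v) = g * o u v * g⁻¹)
    (ho3 : ∀ u v, G.Adj u v →
      (Subgroup.zpowers (o u v) : Set F) = {g : F | g • u = u ∧ g • v = v})
    (v₀ : V) (δ : V → V)
    (hδ : ∀ (v : V) (p : G.Walk v₀ v), p.IsPath → δ v = walkProd o p • v) :
    ∀ (v : V) (p : G.Walk v₀ v), δ v = walkProd o p • v := by
  intro v p
  obtain ⟨q, hq, hqp⟩ := exists_isPath_walkProd_eq hT.isAcyclic o ho1 p
  rw [hδ v q hq, hqp]
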